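/- arXiv:1406.2023 — 9 statements merged into one kernel-verified Lean document; each statement's English description precedes it below -/
import Mathlib

section
/- Let Δ be a set and r a transitive, irreflexive binary relation on Δ. Then r satisfies the smoothness condition — for every subset U ⊆ Δ and every x ∈ U, either x is r-minimal in U or there exists an r-minimal element y of U with r y x — if and only if there is no infinite descending r-chain, i.e. no function f : ℕ → Δ with r (f (n+1)) (f n) for all n ∈ ℕ. -/
/-- For a transitive, irreflexive relation `r` on `Δ`, the smoothness
condition (for every subset `U` and every `x ∈ U`, either `x` is `r`-minimal in `U`
or some `r`-minimal `y ∈ U` satisfies `r y x`) holds if and only if there is no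
infinite descending `r`-chain. -/
theorem smoothness_iff_no_infinite_descending_chain {Δ : Type*} (r : Δ → Δ → Prop)
    (htrans : ∀ x y z, r x y → r y z → r x z)
    (hirrefl : ∀ x, ¬ r x x) :
    (∀ U : Set Δ, ∀ x ∈ U,
        (∀ y ∈ U, ¬ r y x) ∨ ∃ y ∈ U, (∀ z ∈ U, ¬ r z y) ∧ r y x) ↔
      ¬ ∃ f : ℕ → Δ, ∀ n : ℕ, r (f (n + 1)) (f n) := by
  constructor
  · rintro h ⟨f, hf⟩
    obtain hmin | ⟨_, ⟨n, rfl⟩, hmin, -⟩ := h (Set.range f) (f 0) ⟨0, rfl⟩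
    · exact hmin (f 1) ⟨1, rfl⟩ (hf 0)
    · exact hmin (f (n + 1)) ⟨n + 1, rfl⟩ (hf n)
  · intro h U x _
    have hwf : WellFounded r :=
      wellFounded_iff_isEmpty_descending_chain.2 ⟨fun f => h ⟨f.1, f.2⟩⟩
    by_cases hx : ∀ y ∈ U, ¬ r y x
    · exact Or.inl hx
    · push Not at hx
      obtain ⟨y, ⟨hyU, hyx⟩, hmin⟩ := hwf.has_min {y | y ∈ U ∧ r y x} hx
      exact Or.inr ⟨y, hyU, fun z hz hzy => hmin z ⟨hz, htrans z y x hzy hyx⟩ hzy, hyx⟩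
end

section
/- Let Δ be a nonempty set and r a binary relation on Δ. The following are equivalent: (1) r is irreflexive, transitive, modular (for all x, y, z, if r x y then r x z or r z y), and well-founded (every nonempty subset of Δ contains an r-minimal element); (2) there exists a function k : Δ → Ordinal such that for all x, y ∈ Δ, r x y holds if and only if k x < k y. -/
universe u

/-- For a modular well-founded relation, the rank function reflects the order. -/
theorem rel_of_rank_lt_rank {α : Type u} {r : α → α → Prop} [IsWellFounded α r]
    (hmod : ∀ x y z, r x y → r x z ∨ r z y) {x y : α}
    (h : IsWellFounded.rank r x < IsWellFounded.rank r y) : r x y := by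
  by_contra hxy
  refine h.not_ge ?_
  rw [IsWellFounded.rank_eq r y]
  exact Ordinal.iSup_le fun ⟨z, hz⟩ => Order.succ_le_of_lt
    (IsWellFounded.rank_lt_of_rel ((hmod z y x hz).resolve_right hxy))

/-- For a relation `r` on a nonempty `Δ`: `r` is irreflexive, transitive,
modular and well-founded iff there is a ranking `k : Δ → Ordinal` with
`r x y ↔ k x < k y`. -/
theorem irrefl_trans_modular_wf_iff_exists_ranking {Δ : Type u} [Nonempty Δ]
    (r : Δ → Δ → Prop) :
    ((∀ x, ¬ r x x) ∧
     (∀ x y z, r x y → r y z → r x z) ∧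
     (∀ x y z, r x y → r x z ∨ r z y) ∧
     (∀ U : Set Δ, U.Nonempty → ∃ x ∈ U, ∀ y ∈ U, ¬ r y x)) ↔
      ∃ k : Δ → Ordinal.{u}, ∀ x y, r x y ↔ k x < k y := by
  constructor
  · rintro ⟨-, -, hmod, hmin⟩
    have : IsWellFounded Δ r := ⟨WellFounded.wellFounded_iff_has_min.2 hmin⟩
    exact ⟨IsWellFounded.rank r, fun _ _ =>
      ⟨IsWellFounded.rank_lt_of_rel, rel_of_rank_lt_rank hmod⟩⟩
  · rintro ⟨k, hk⟩
    simp only [hk]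
    exact ⟨fun x => lt_irrefl (k x), fun _ _ _ => lt_trans,
      fun x _ z h => (lt_or_ge (k x) (k z)).imp_right (·.trans_lt h),
      (InvImage.wf k Ordinal.lt_wf).has_min⟩
end

section
/- Let Δ be a type, k : Δ → Ordinal a ranking, and C, D ⊆ Δ with C nonempty. Then every k-minimal element of C belongs to D if and only if either C ∩ Dᶜ = ∅, or both C ∩ D ≠ ∅ and rk_k(C ∩ D) < rk_k(C ∩ Dᶜ). (In the paper's convention, where the rank of the empty set is ∞, this reads: the typicality inclusion T(C) ⊑ D holds in the ranked model induced by k iff k(C ⊓ D) < k(C ⊓ ¬D).) -/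
universe u

/-- In the ranked model induced by `k`, a typicality inclusion
`T(C) ⊑ D` (every `k`-minimal element of `C` is in `D`), for nonempty `C`, holds iff
either `C ∩ Dᶜ = ∅`, or `C ∩ D` is nonempty and `rk(C ∩ D) < rk(C ∩ Dᶜ)`,
where `rk(A) = sInf (k '' A)`. -/
theorem typicality_inclusion_iff_rank_lt {Δ : Type u} (k : Δ → Ordinal.{u})
    (C D : Set Δ) (hC : C.Nonempty) :
    (∀ x ∈ C, (∀ y ∈ C, ¬ k y < k x) → x ∈ D) ↔
      (C ∩ Dᶜ = ∅ ∨
        ((C ∩ D).Nonempty ∧ sInf (k '' (C ∩ D)) < sInf (k '' (C ∩ Dᶜ)))) := by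
  constructor
  · intro h
    rcases (C ∩ Dᶜ).eq_empty_or_nonempty with hE | hE
    · exact Or.inl hE
    · obtain ⟨z, ⟨hzC, hzD⟩, hz⟩ := csInf_mem (hE.image k)
      have hnot : ¬ ∀ y ∈ C, ¬ k y < k z := fun hmin => hzD (h z hzC hmin)
      push Not at hnot
      obtain ⟨y, hyC, hyz⟩ := hnot
      rw [hz] at hyz
      have hyD : y ∈ D := by
        by_contra hyD
        exact notMem_of_lt_csInf' hyz ⟨y, ⟨hyC, hyD⟩, rfl⟩
      refine Or.inr ⟨⟨y, hyC, hyD⟩, ?_⟩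
      exact lt_of_le_of_lt (csInf_le' ⟨y, ⟨hyC, hyD⟩, rfl⟩) hyz
  · intro h x hxC hmin
    by_contra hxD
    rcases h with hE | ⟨hne, hlt⟩
    · exact hE.subset ⟨hxC, hxD⟩
    · obtain ⟨y, ⟨hyC, -⟩, hy⟩ := csInf_mem (hne.image k)
      rw [← hy] at hlt
      exact hmin y hyC (hlt.trans_le (csInf_le' ⟨x, ⟨hxC, hxD⟩, rfl⟩))
end

section
/- Fix a type Δ, a finite index type ι, and a defeasible knowledge base (Cᵢ, Dᵢ)_{i ∈ ι}. Suppose there exists at least one satisfying ranking. Define k_min : Δ → Ordinal by k_min(x) = sInf { k'(x) | k' is a satisfying ranking }. Then k_min is itself a satisfying ranking; consequently k_min(x) ≤ k'(x) for every satisfying ranking k' and every x ∈ Δ, so in particular a minimal satisfying ranking exists. -/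
universe u v

/-- A ranking `k` satisfies the defeasible knowledge base `(Cᵢ, Dᵢ)` if, for every `i`,
every `k`-minimal element of `Cᵢ` belongs to `Dᵢ`. -/
def Satisfies {Δ : Type u} {ι : Type v} (C D : ι → Set Δ) (k : Δ → Ordinal.{u}) : Prop :=
  ∀ i : ι, ∀ x ∈ C i, (∀ y ∈ C i, ¬ k y < k x) → x ∈ D i

/-- The pointwise infimum of all satisfying rankings is attained at each point by some satisfying
ranking. -/
theorem exists_satisfies_apply_eq_sInf {Δ : Type u} {ι : Type v} {C D : ι → Set Δ}
    (hex : ∃ k : Δ → Ordinal.{u}, Satisfies C D k) (x : Δ) :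
    ∃ k, Satisfies C D k ∧ k x = sInf {o : Ordinal.{u} | ∃ k', Satisfies C D k' ∧ k' x = o} :=
  let ⟨k, hk⟩ := hex
  csInf_mem (s := {o : Ordinal.{u} | ∃ k', Satisfies C D k' ∧ k' x = o}) ⟨k x, k, hk, rfl⟩

/-- The pointwise infimum of all satisfying rankings is a lower bound of each of them. -/
theorem Satisfies.sInf_le {Δ : Type u} {ι : Type v} {C D : ι → Set Δ} {k : Δ → Ordinal.{u}}
    (hk : Satisfies C D k) (x : Δ) :
    sInf {o : Ordinal.{u} | ∃ k', Satisfies C D k' ∧ k' x = o} ≤ k x :=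
  csInf_le' ⟨k, hk, rfl⟩

/-- The pointwise infimum of all satisfying rankings is satisfying: a minimal element `x` of `C i`
for the infimum is also minimal for a satisfying ranking attaining the infimum at `x`. -/
theorem satisfies_sInf {Δ : Type u} {ι : Type v} {C D : ι → Set Δ}
    (hex : ∃ k : Δ → Ordinal.{u}, Satisfies C D k) :
    Satisfies C D (fun x => sInf {o : Ordinal.{u} | ∃ k', Satisfies C D k' ∧ k' x = o}) := by
  intro i x hx hmin
  obtain ⟨k, hk, hkx⟩ := exists_satisfies_apply_eq_sInf hex x
  exact hk i x hx fun y hy hlt => hmin y hy ((hk.sInf_le y).trans_lt (hlt.trans_eq hkx))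

/-- If some satisfying ranking exists, then the pointwise infimum
`k_min x = sInf { k' x | k' satisfying }` is itself a satisfying ranking; consequently
`k_min ≤ k'` pointwise for every satisfying ranking `k'`, and in particular a minimal
satisfying ranking exists. -/
theorem pointwise_inf_is_satisfying {Δ : Type u} {ι : Type v} [Finite ι]
    (C D : ι → Set Δ)
    (hex : ∃ k : Δ → Ordinal.{u}, Satisfies C D k) :
    Satisfies C D
        (fun x => sInf {o : Ordinal.{u} | ∃ k', Satisfies C D k' ∧ k' x = o}) ∧
    (∀ k' : Δ → Ordinal.{u}, Satisfies C D k' → ∀ x : Δ,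
        sInf {o : Ordinal.{u} | ∃ k'', Satisfies C D k'' ∧ k'' x = o} ≤ k' x) ∧
    (∃ k₀ : Δ → Ordinal.{u}, Satisfies C D k₀ ∧
        ¬ ∃ k' : Δ → Ordinal.{u}, Satisfies C D k' ∧
            (∀ x, k' x ≤ k₀ x) ∧ ∃ y, k' y < k₀ y) := by
  refine ⟨satisfies_sInf hex, fun k' hk' x => hk'.sInf_le x, _, satisfies_sInf hex, ?_⟩
  rintro ⟨k', hk', -, y, hy⟩
  exact (hk'.sInf_le y).not_gt hy
end

section
/- Fix a type Δ, a finite index type ι, and a defeasible knowledge base (Cᵢ, Dᵢ)_{i ∈ ι}. Let k : Δ → Ordinal be a ranking such that for every x ∈ Δ: (a) if k(x) = 0 then S_x^k = ∅, and (b) for every i ∈ S_x^k, rk_k(Cᵢ) < k(x). Then k is a satisfying ranking, i.e. for every i ∈ ι, every k-minimal element of Cᵢ belongs to Dᵢ. -/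
universe u v

/-- `Sfalsified C D x` is the set of (indices of) defeasible inclusions falsified by
`x`, i.e. those `i` with `x ∈ Cᵢ \ Dᵢ`. -/
def Sfalsified {Δ : Type u} {ι : Type v} (C D : ι → Set Δ) (x : Δ) : Set ι :=
  {i | x ∈ C i ∧ x ∉ D i}

/-- If a ranking `k` is such that for every `x`: (a) `k x = 0` implies
`S_x^k = ∅`, and (b) `rk_k(Cᵢ) < k x` for every `i ∈ S_x^k`, then `k` is a satisfying
ranking. -/
theorem rank_conditions_imply_satisfying {Δ : Type u} {ι : Type v} [Finite ι]
    (C D : ι → Set Δ) (k : Δ → Ordinal.{u})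
    (ha : ∀ x : Δ, k x = 0 → Sfalsified C D x = ∅)
    (hb : ∀ x : Δ, ∀ i ∈ Sfalsified C D x, sInf (k '' C i) < k x) :
    Satisfies C D k := by
  intro i x hx hmin
  by_contra hD
  obtain ⟨y, hy, hyk⟩ := csInf_mem (Set.Nonempty.image k ⟨x, hx⟩)
  exact hmin y hy (hyk ▸ hb x i ⟨hx, hD⟩)
end

section
/- Fix a type Δ, a finite index type ι, and a defeasible knowledge base (Cᵢ, Dᵢ)_{i ∈ ι}. Let k be a minimal satisfying ranking. Then for every x ∈ Δ: (a) if S_x^k = ∅ then k(x) = 0; (b) if S_x^k ≠ ∅ then k(x) is the ordinal successor of max{ rk_k(Cᵢ) | i ∈ S_x^k }, i.e. k(x) = (max_{i ∈ S_x^k} rk_k(Cᵢ)) + 1. -/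
universe u v

/-- A satisfying ranking `k` is minimal if no satisfying ranking is pointwise `≤ k`
and strictly smaller somewhere. -/
def MinimalSatisfying {Δ : Type u} {ι : Type v} (C D : ι → Set Δ)
    (k : Δ → Ordinal.{u}) : Prop :=
  Satisfies C D k ∧
    ¬ ∃ k' : Δ → Ordinal.{u}, Satisfies C D k' ∧
        (∀ x, k' x ≤ k x) ∧ ∃ y, k' y < k y

/-- In a minimal satisfying ranking, `k x ≤ a` as soon as every `C i` with `i` falsified by `x`
has an element of rank below `a`. -/
theorem MinimalSatisfying.le_of_forall_exists_lt {Δ : Type u} {ι : Type v} {C D : ι → Set Δ}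
    {k : Δ → Ordinal.{u}} (hmin : MinimalSatisfying C D k) {x : Δ} {a : Ordinal.{u}}
    (h : ∀ i ∈ Sfalsified C D x, ∃ y ∈ C i, k y < a) : k x ≤ a := by
  classical
  by_contra! ha
  have hle : ∀ y, Function.update k x a y ≤ k y := by
    intro y
    rcases eq_or_ne y x with rfl | hy
    · simpa using ha.le
    · simp [hy]
  refine hmin.2 ⟨Function.update k x a, fun i z hz hzmin => ?_, hle, x, by simpa using ha⟩
  by_contra hD
  rcases eq_or_ne z x with rfl | hzx
  · obtain ⟨y, hy, hya⟩ := h i ⟨hz, hD⟩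
    exact hzmin y hy (by simpa using (hle y).trans_lt hya)
  · refine hD (hmin.1 i z hz fun y hy hyz => hzmin y hy ?_)
    simpa [hzx] using (hle y).trans_lt hyz

/-- An element of `C i` outside `D i` has rank above the rank of `C i`. -/
theorem Satisfies.sInf_image_lt {Δ : Type u} {ι : Type v} {C D : ι → Set Δ}
    {k : Δ → Ordinal.{u}} (hk : Satisfies C D k) {x : Δ} {i : ι}
    (hi : i ∈ Sfalsified C D x) : sInf (k '' C i) < k x := by
  by_contra! h
  exact hi.2 (hk i x hi.1 fun y hy hyx =>
    (h.trans (csInf_le' (Set.mem_image_of_mem k hy))).not_gt hyx)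

/-- If `k` is a minimal satisfying ranking, then for every `x`:
(a) if `S_x^k = ∅` then `k x = 0`; (b) if `S_x^k ≠ ∅` then
`k x = (max_{i ∈ S_x^k} rk_k(Cᵢ)) + 1`, where `rk_k(A) = sInf (k '' A)`. -/
theorem minimal_satisfying_rank_characterization_forward {Δ : Type u} {ι : Type v}
    [Finite ι] (C D : ι → Set Δ) (k : Δ → Ordinal.{u})
    (hmin : MinimalSatisfying C D k) (x : Δ) :
    (Sfalsified C D x = ∅ → k x = 0) ∧
    (Sfalsified C D x ≠ ∅ →
      k x = sSup ((fun i => sInf (k '' C i)) '' Sfalsified C D x) + 1) := by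
  refine ⟨fun h => ?_, fun h => le_antisymm ?_ ?_⟩
  · exact le_antisymm (hmin.le_of_forall_exists_lt (by simp [h])) zero_le
  · refine hmin.le_of_forall_exists_lt fun i hi => ?_
    obtain ⟨y, hy, hyk⟩ := csInf_mem (Set.Nonempty.image k ⟨x, hi.1⟩)
    refine ⟨y, hy, hyk.trans_lt (Order.lt_add_one_iff.2 ?_)⟩
    exact le_csSup (Set.toFinite _).bddAbove (Set.mem_image_of_mem _ hi)
  · obtain ⟨i, hi, his⟩ := Set.Nonempty.csSup_mem
      ((Set.nonempty_iff_ne_empty.2 h).image fun i => sInf (k '' C i)) (Set.toFinite _)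
    rw [← his]
    exact Order.add_one_le_of_lt (hmin.1.sInf_image_lt hi)
end

section
/- Fix a type Δ, a finite index type ι, and a defeasible knowledge base (Cᵢ, Dᵢ)_{i ∈ ι}. Let k : Δ → Ordinal be a ranking such that for every x ∈ Δ: (a) S_x^k = ∅ if and only if k(x) = 0, and (b) if S_x^k ≠ ∅ then k(x) = (max_{i ∈ S_x^k} rk_k(Cᵢ)) + 1 (ordinal successor of the maximum). Then k is a satisfying ranking and it is minimal; indeed for every satisfying ranking k' one has k(x) ≤ k'(x) for all x ∈ Δ. -/
universe u v

/-- If a ranking `k` is such that for every `x`: (a) `S_x^k = ∅` iff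
`k x = 0`, and (b) if `S_x^k ≠ ∅` then `k x = (max_{i ∈ S_x^k} rk_k(Cᵢ)) + 1`, then
`k` is a satisfying ranking and it is minimal; indeed `k ≤ k'` pointwise for every
satisfying ranking `k'`. -/
theorem rank_characterization_implies_minimal {Δ : Type u} {ι : Type v} [Finite ι]
    (C D : ι → Set Δ) (k : Δ → Ordinal.{u})
    (ha : ∀ x : Δ, Sfalsified C D x = ∅ ↔ k x = 0)
    (hb : ∀ x : Δ, Sfalsified C D x ≠ ∅ →
      k x = sSup ((fun i => sInf (k '' C i)) '' Sfalsified C D x) + 1) :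
    Satisfies C D k ∧
    (¬ ∃ k' : Δ → Ordinal.{u}, Satisfies C D k' ∧
        (∀ x, k' x ≤ k x) ∧ ∃ y, k' y < k y) ∧
    (∀ k' : Δ → Ordinal.{u}, Satisfies C D k' → ∀ x : Δ, k x ≤ k' x) := by
  have hle : ∀ k' : Δ → Ordinal.{u}, Satisfies C D k' → ∀ x : Δ, k x ≤ k' x := by
    intro k' hk' x
    induction x using (InvImage.wf k' Ordinal.lt_wf).induction with
    | _ x ih =>
      by_cases hS : Sfalsified C D x = ∅
      · simp [(ha x).1 hS]
      obtain ⟨i, hi, hmax⟩ := ((Set.nonempty_iff_ne_empty.2 hS).image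
        fun i => sInf (k '' C i)).csSup_mem (Set.toFinite _)
      obtain ⟨y, hy, hyx⟩ : ∃ y ∈ C i, k' y < k' x := by
        by_contra! h
        exact hi.2 (hk' i x hi.1 fun y hy => (h y hy).not_gt)
      rw [hb x hS, ← hmax, ← Order.succ_eq_add_one, Order.succ_le_iff]
      exact ((csInf_le' (Set.mem_image_of_mem k hy)).trans (ih y hyx)).trans_lt hyx
  refine ⟨fun i x hx hmin => ?_, fun ⟨k', hk', _, y, hy⟩ => (hle k' hk' y).not_gt hy, hle⟩
  by_contra hxD
  have hi : i ∈ Sfalsified C D x := ⟨hx, hxD⟩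
  have hrank : k x ≤ sInf (k '' C i) := by
    refine le_csInf ⟨_, Set.mem_image_of_mem k hx⟩ ?_
    rintro _ ⟨y, hy, rfl⟩
    exact not_lt.1 (hmin y hy)
  have hsup : sInf (k '' C i) ≤ sSup ((fun i => sInf (k '' C i)) '' Sfalsified C D x) :=
    le_csSup (Set.toFinite _).bddAbove (Set.mem_image_of_mem _ hi)
  refine (hrank.trans hsup).not_gt ?_
  conv_rhs => rw [hb x (Set.nonempty_iff_ne_empty.1 ⟨i, hi⟩)]
  exact lt_add_one _
end

section
/- Fix a type Δ, a finite index type ι, and a defeasible knowledge base (Cᵢ, Dᵢ)_{i ∈ ι}. For a ranking k : Δ → Ordinal, the following are equivalent: (1) k is a minimal satisfying ranking; (2) for every x ∈ Δ: (a) S_x^k = ∅ if and only if k(x) = 0, and (b) if S_x^k ≠ ∅ then k(x) = (max_{i ∈ S_x^k} rk_k(Cᵢ)) + 1 (ordinal successor of the maximum). -/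
universe u v

/-- A ranking satisfies the knowledge base iff every element lies strictly above the rank of
each inclusion it falsifies. -/
theorem satisfies_iff_sInf_lt {Δ : Type u} {ι : Type v} (C D : ι → Set Δ)
    (k : Δ → Ordinal.{u}) :
    Satisfies C D k ↔ ∀ x, ∀ i ∈ Sfalsified C D x, sInf (k '' C i) < k x := by
  constructor
  · rintro h x i ⟨hC, hD⟩
    by_contra hlt
    exact hD (h i x hC fun y hy hyx =>
      hlt ((csInf_le' (Set.mem_image_of_mem k hy)).trans_lt hyx))
  · intro h i x hC hmin
    by_contra hD
    obtain ⟨y, hy, hyk⟩ := csInf_mem (Set.Nonempty.image k ⟨x, hC⟩)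
    exact hmin y hy (hyk.trans_lt (h x i ⟨hC, hD⟩))

/-- If `k x` is at most the successor of the largest rank falsified at `x` (and `0` if nothing is
falsified at `x`), then `k` lies below every satisfying ranking. -/
theorem le_of_satisfies {Δ : Type u} {ι : Type v} [Finite ι] {C D : ι → Set Δ}
    {k k' : Δ → Ordinal.{u}} (h0 : ∀ x, Sfalsified C D x = ∅ → k x = 0)
    (h1 : ∀ x, Sfalsified C D x ≠ ∅ →
      k x ≤ sSup ((fun i => sInf (k '' C i)) '' Sfalsified C D x) + 1)
    (hk' : Satisfies C D k') (x : Δ) : k x ≤ k' x := by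
  rw [satisfies_iff_sInf_lt] at hk'
  induction x using (InvImage.wf k' wellFounded_lt).induction with
  | _ x ih =>
    by_cases hS : Sfalsified C D x = ∅
    · simp [h0 x hS]
    · obtain ⟨i, hi, hmax⟩ :=
        ((Set.nonempty_iff_ne_empty.2 hS).image fun i => sInf (k '' C i)).csSup_mem
          (Set.toFinite (Sfalsified C D x) |>.image _)
      obtain ⟨z, hz, hzk⟩ := csInf_mem (Set.Nonempty.image k' ⟨x, hi.1⟩)
      have hzx : k' z < k' x := hzk.trans_lt (hk' x i hi)
      refine (h1 x hS).trans ?_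
      rw [← hmax]
      exact Order.add_one_le_of_lt
        (((csInf_le' (Set.mem_image_of_mem k hz)).trans (ih z hzx)).trans_lt hzx)

/-- A ranking `k` is a minimal satisfying ranking iff for every `x`:
(a) `S_x^k = ∅` iff `k x = 0`, and (b) if `S_x^k ≠ ∅` then
`k x = (max_{i ∈ S_x^k} rk_k(Cᵢ)) + 1`. -/
theorem minimal_satisfying_iff_rank_characterization {Δ : Type u} {ι : Type v}
    [Finite ι] (C D : ι → Set Δ) (k : Δ → Ordinal.{u}) :
    MinimalSatisfying C D k ↔
      ∀ x : Δ,
        (Sfalsified C D x = ∅ ↔ k x = 0) ∧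
        (Sfalsified C D x ≠ ∅ →
          k x = sSup ((fun i => sInf (k '' C i)) '' Sfalsified C D x) + 1) := by
  have lt_rank : ∀ x, ∀ i ∈ Sfalsified C D x, sInf (k '' C i) <
      sSup ((fun i => sInf (k '' C i)) '' Sfalsified C D x) + 1 := fun x i hi =>
    Order.lt_add_one_iff.2 (le_csSup (Set.toFinite (Sfalsified C D x) |>.image _).bddAbove
      ⟨i, hi, rfl⟩)
  constructor
  · rintro ⟨hk, hmin⟩
    rw [satisfies_iff_sInf_lt] at hk
    classical
    let k' : Δ → Ordinal.{u} := fun x =>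
      if Sfalsified C D x = ∅ then 0
      else sSup ((fun i => sInf (k '' C i)) '' Sfalsified C D x) + 1
    have hle : ∀ x, k' x ≤ k x := by
      intro x
      by_cases hS : Sfalsified C D x = ∅
      · simp [k', hS]
      · simp only [k', if_neg hS]
        obtain ⟨i, hi, hmax⟩ :=
          ((Set.nonempty_iff_ne_empty.2 hS).image fun i => sInf (k '' C i)).csSup_mem
            (Set.toFinite (Sfalsified C D x) |>.image _)
        rw [← hmax]
        exact Order.add_one_le_of_lt (hk x i hi)
    have hk' : Satisfies C D k' := by
      rw [satisfies_iff_sInf_lt]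
      intro x i hi
      have hS : Sfalsified C D x ≠ ∅ := Set.nonempty_iff_ne_empty.1 ⟨i, hi⟩
      obtain ⟨z, hz, hzk⟩ := csInf_mem (Set.Nonempty.image k ⟨x, hi.1⟩)
      simp only [k', if_neg hS]
      refine lt_of_le_of_lt ?_ (lt_rank x i hi)
      rw [← hzk]
      exact (csInf_le' (Set.mem_image_of_mem k' hz)).trans (hle z)
    have heq : ∀ x, k x = k' x := fun x =>
      le_antisymm (not_lt.1 fun hlt => hmin ⟨k', hk', hle, x, hlt⟩) (hle x)
    intro x
    by_cases hS : Sfalsified C D x = ∅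
    · simp [heq x, k', hS]
    · have hx : k x = sSup ((fun i => sInf (k '' C i)) '' Sfalsified C D x) + 1 := by
        rw [heq x]
        exact if_neg hS
      refine ⟨⟨fun h => absurd h hS, fun h => ?_⟩, fun _ => hx⟩
      rw [hx] at h
      simp at h
  · intro h
    refine ⟨(satisfies_iff_sInf_lt C D k).2 fun x i hi => ?_, ?_⟩
    · rw [(h x).2 (Set.nonempty_iff_ne_empty.1 ⟨i, hi⟩)]
      exact lt_rank x i hi
    · rintro ⟨k', hk', -, y, hy⟩
      exact hy.not_ge (le_of_satisfies (fun x => (h x).1.1) (fun x hS => ((h x).2 hS).le) hk' y)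
end

section
/- Fix a type Δ, a finite index type ι, and a defeasible knowledge base (Cᵢ, Dᵢ)_{i ∈ ι}. Let k be a minimal satisfying ranking. Then for every x ∈ Δ, k(x) is a finite ordinal, i.e. k(x) < ω; hence the domain elements of any minimal model of a finite knowledge base have finite rank, even when Δ is infinite. -/
universe u v

/-- A finite set of ordinals below `a` has at most `a` elements. -/
theorem natCast_ncard_le_of_subset_Iio {s : Set Ordinal.{u}} {a : Ordinal.{u}}
    (hs : s ⊆ Set.Iio a) : (s.ncard : Ordinal.{u}) ≤ a := by
  rcases lt_or_ge a Ordinal.omega0 with ha | ha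
  · obtain ⟨n, rfl⟩ := Ordinal.lt_omega0.mp ha
    have hsub : s ⊆ (Nat.cast : ℕ → Ordinal.{u}) '' Set.Iio n := by
      intro b hb
      have hbn : b < (n : Ordinal.{u}) := hs hb
      obtain ⟨m, rfl⟩ := Ordinal.lt_omega0.mp (hbn.trans ha)
      exact ⟨m, by exact_mod_cast hbn, rfl⟩
    have hfin : (Set.Iio n).Finite := Set.finite_Iio n
    have hcard : s.ncard ≤ n := calc
      s.ncard ≤ _ := Set.ncard_le_ncard hsub (hfin.image _)
      _ ≤ (Set.Iio n).ncard := Set.ncard_image_le hfin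
      _ = n := by simp [Set.ncard_eq_toFinset_card']
    exact_mod_cast hcard
  · exact (Ordinal.natCast_lt_omega0 _).le.trans ha

/-- The ranking that sends `x` to the number of elements of `M` below `k x`. -/
noncomputable def compressedRank {Δ : Type u} (M : Set Ordinal.{u}) (k : Δ → Ordinal.{u})
    (x : Δ) : Ordinal.{u} :=
  ((M ∩ Set.Iio (k x)).ncard : Ordinal.{u})

theorem compressedRank_lt {Δ : Type u} {M : Set Ordinal.{u}} (hM : M.Finite)
    {k : Δ → Ordinal.{u}} {x y : Δ} (hy : k y ∈ M) (hyx : k y < k x) :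
    compressedRank M k y < compressedRank M k x := by
  have hlt : (M ∩ Set.Iio (k y)).ncard < (M ∩ Set.Iio (k x)).ncard := by
    refine Set.ncard_lt_ncard ?_ (hM.inter_of_left _)
    refine (Set.ssubset_iff_of_subset ?_).mpr ⟨k y, ⟨hy, hyx⟩, fun h => lt_irrefl (k y) h.2⟩
    exact Set.inter_subset_inter_right _ (Set.Iio_subset_Iio hyx.le)
  unfold compressedRank
  exact_mod_cast hlt

/-- Compressing along a finite set that contains the least rank of every nonempty `C i`
preserves satisfaction. -/
theorem Satisfies.compressedRank {Δ : Type u} {ι : Type v} {C D : ι → Set Δ}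
    {k : Δ → Ordinal.{u}} (hk : Satisfies C D k) {M : Set Ordinal.{u}} (hM : M.Finite)
    (hmem : ∀ i, (C i).Nonempty → sInf (k '' C i) ∈ M) :
    Satisfies C D (compressedRank M k) := by
  intro i x hx hxmin
  refine hk i x hx fun z hz hzx => ?_
  obtain ⟨y, hy, hyk⟩ := csInf_mem (Set.Nonempty.image k ⟨x, hx⟩)
  have hyz : k y ≤ k z := hyk ▸ csInf_le' (Set.mem_image_of_mem k hz)
  exact hxmin y hy
    (compressedRank_lt hM (hyk ▸ hmem i ⟨x, hx⟩) (hyz.trans_lt hzx))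

/-- If `k` is a minimal satisfying ranking (for a finite knowledge base),
then every domain element has finite rank: `k x < ω` for all `x`, even when `Δ` is
infinite. -/
theorem minimal_satisfying_rank_finite {Δ : Type u} {ι : Type v} [Finite ι]
    (C D : ι → Set Δ) (k : Δ → Ordinal.{u})
    (hmin : MinimalSatisfying C D k) :
    ∀ x : Δ, k x < Ordinal.omega0 := by
  intro x
  by_contra! hx
  refine hmin.2 ⟨compressedRank (Set.range fun i => sInf (k '' C i)) k,
    hmin.1.compressedRank (Set.finite_range _) fun i _ => Set.mem_range_self i,
    fun _ => natCast_ncard_le_of_subset_Iio Set.inter_subset_right,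
    x, (Ordinal.natCast_lt_omega0 _).trans_le hx⟩
end
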